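/- Let (X,d) be a compact metric space of diameter at most 1 and F : X → 2^X an upper semicontinuous, onto and open set-valued map with nonempty compact values. Then F has the shadowing property if and only if the induced inverse set-valued map F_inv on Orb_inv(X) has the shadowing property (as a set-valued map on the compact metric space (Orb_inv(X), ρ)). -/

import Mathlib

open Metric Set

variable {X : Type*} [MetricSpace X]

/-- A set-valued map `F : X → 2^X` is *upper semicontinuous* if for every `x` and every open
`U ⊇ F x` there is an open neighborhood `V` of `x` with `F y ⊆ U` for all `y ∈ V`. -/
def SVUpperSC (F : X → Set X) : Prop :=
  ∀ x : X, ∀ U : Set X, IsOpen U → F x ⊆ U →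
    ∃ V : Set X, IsOpen V ∧ x ∈ V ∧ ∀ y ∈ V, F y ⊆ U

/-- A set-valued map is *lower semicontinuous* if for every `x` and every open `U` meeting
`F x` there is an open neighborhood `V` of `x` with `F y ∩ U ≠ ∅` for all `y ∈ V`. -/
def SVLowerSC (F : X → Set X) : Prop :=
  ∀ x : X, ∀ U : Set X, IsOpen U → (F x ∩ U).Nonempty →
    ∃ V : Set X, IsOpen V ∧ x ∈ V ∧ ∀ y ∈ V, (F y ∩ U).Nonempty

/-- A set-valued map is *continuous* if it is both upper and lower semicontinuous. -/
def SVContinuous (F : X → Set X) : Prop := SVUpperSC F ∧ SVLowerSC F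

/-- `F` has nonempty compact values. -/
def SVCompactValued (F : X → Set X) : Prop := ∀ x : X, (F x).Nonempty ∧ IsCompact (F x)

/-- Image of a set under a set-valued map: `F(U) = ⋃_{x ∈ U} F x`. -/
def SVImage (F : X → Set X) (U : Set X) : Set X := ⋃ x ∈ U, F x

/-- A set-valued map is *open* if it maps open sets to open sets. -/
def SVOpen (F : X → Set X) : Prop := ∀ U : Set X, IsOpen U → IsOpen (SVImage F U)

/-- A set-valued map is *onto* if every point lies in some value. -/
def SVOnto (F : X → Set X) : Prop := ∀ y : X, ∃ x : X, y ∈ F x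

/-- The inverse set-valued map `F⁻¹(x) = {z : x ∈ F z}`. -/
def SVInv (F : X → Set X) : X → Set X := fun x => {z | x ∈ F z}

/-- The orbit space `Orb_r(X) = {(x_n) : x_{n+1} ∈ F(x_n)}`. -/
def OrbR (F : X → Set X) : Set (ℕ → X) := {u | ∀ n : ℕ, u (n + 1) ∈ F (u n)}

/-- The left orbit space `Orb_l(X) = {(…,x_{-1},x_0) : x_i ∈ F(x_{i+1})}`, encoded by
`u n = x_{-n}`, so the defining condition reads `u (n+1) ∈ F (u n)`. -/
def OrbL (F : X → Set X) : Set (ℕ → X) := {u | ∀ n : ℕ, u (n + 1) ∈ F (u n)}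

/-- The inverse orbit space `Orb_inv(X) = {(x_n) : x_n ∈ F(x_{n+1})}`. -/
def OrbInv (F : X → Set X) : Set (ℕ → X) := {u | ∀ n : ℕ, u n ∈ F (u (n + 1))}

/-- The shift on sequences. -/
def shiftSeq (u : ℕ → X) : ℕ → X := fun n => u (n + 1)

/-- The shift map `σ_rF : Orb_r(X) → Orb_r(X)`, `(x_n) ↦ (x_{n+1})`. -/
def sigmaR (F : X → Set X) : OrbR F → OrbR F :=
  fun u => ⟨shiftSeq u.1, fun n => u.2 (n + 1)⟩

/-- The shift map `σ_lF : Orb_l(X) → Orb_l(X)`, `(x_{-n}) ↦ (x_{-n-1})`, in the encoding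
`u n = x_{-n}`. -/
def sigmaL (F : X → Set X) : OrbL F → OrbL F :=
  fun u => ⟨shiftSeq u.1, fun n => u.2 (n + 1)⟩

/-- The metric `ρ((x_n),(y_n)) = Σ_{n≥0} d(x_n,y_n)/2^{n+1}` on sequence space. -/
noncomputable def rho (u v : ℕ → X) : ℝ := ∑' n : ℕ, dist (u n) (v n) / 2 ^ (n + 1)

/-- `ρ`-distance from a point to a set of sequences. -/
noncomputable def rhoInf (u : ℕ → X) (B : Set (ℕ → X)) : ℝ := sInf (rho u '' B)

/-- Hausdorff distance with respect to `ρ` between two sets of sequences. -/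
noncomputable def rhoHaus (A B : Set (ℕ → X)) : ℝ :=
  max (sSup ((fun u => rhoInf u B) '' A)) (sSup ((fun v => rhoInf v A) '' B))

/-- The shadowing property for a set-valued map: every `δ`-pseudo-orbit
(`d(x_{n+1}, F(x_n)) < δ`) is `ε`-shadowed by an `F`-orbit. -/
def SVShadowing (F : X → Set X) : Prop :=
  ∀ ε > (0 : ℝ), ∃ δ > (0 : ℝ), ∀ x : ℕ → X,
    (∀ n : ℕ, infDist (x (n + 1)) (F (x n)) < δ) →
    ∃ y : ℕ → X, (∀ n : ℕ, y (n + 1) ∈ F (y n)) ∧ ∀ n : ℕ, dist (x n) (y n) < ε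

/-- The (single-valued) shadowing property for the shift `σ_rF` on `(Orb_r(X), ρ)`. -/
def ShiftShadowingR (F : X → Set X) : Prop :=
  ∀ ε > (0 : ℝ), ∃ δ > (0 : ℝ), ∀ z : ℕ → (ℕ → X),
    (∀ n : ℕ, z n ∈ OrbR F) →
    (∀ n : ℕ, rho (shiftSeq (z n)) (z (n + 1)) < δ) →
    ∃ w ∈ OrbR F, ∀ n : ℕ, rho (shiftSeq^[n] w) (z n) < ε

/-- The (single-valued) shadowing property for the shift `σ_lF` on `(Orb_l(X), ρ)`. -/
def ShiftShadowingL (F : X → Set X) : Prop :=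
  ∀ ε > (0 : ℝ), ∃ δ > (0 : ℝ), ∀ z : ℕ → (ℕ → X),
    (∀ n : ℕ, z n ∈ OrbL F) →
    (∀ n : ℕ, rho (shiftSeq (z n)) (z (n + 1)) < δ) →
    ∃ w ∈ OrbL F, ∀ n : ℕ, rho (shiftSeq^[n] w) (z n) < ε

/-- `F` is expansive with expansive constant `δ`. -/
def SVExpansiveWith (F : X → Set X) (δ : ℝ) : Prop :=
  ∀ u ∈ OrbR F, ∀ v ∈ OrbR F, (∀ n : ℕ, dist (u n) (v n) < δ) → u 0 = v 0

/-- The shift `σ_rF` is expansive (as a single-valued map on `(Orb_r(X), ρ)`)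
with expansive constant `c`. -/
def ShiftExpansiveWith (F : X → Set X) (c : ℝ) : Prop :=
  ∀ u ∈ OrbR F, ∀ v ∈ OrbR F,
    (∀ k : ℕ, rho (shiftSeq^[k] u) (shiftSeq^[k] v) ≤ c) → u = v

/-- The induced set-valued map `F_inv` on `Orb_inv(X)`: `F_inv([x_n]) = F(x_0) × [x_n]`,
i.e. all sequences `(z, x_0, x_1, …)` with `z ∈ F(x_0)`. -/
def Finv (F : X → Set X) (u : ℕ → X) : Set (ℕ → X) :=
  {v | v 0 ∈ F (u 0) ∧ ∀ n : ℕ, v (n + 1) = u n}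

/-- The shadowing property of `F_inv` as a set-valued map on `(Orb_inv(X), ρ)`. -/
def FinvShadowing (F : X → Set X) : Prop :=
  ∀ ε > (0 : ℝ), ∃ δ > (0 : ℝ), ∀ x : ℕ → (ℕ → X),
    (∀ n : ℕ, x n ∈ OrbInv F) →
    (∀ n : ℕ, rhoInf (x (n + 1)) (Finv F (x n)) < δ) →
    ∃ y : ℕ → (ℕ → X), (∀ n : ℕ, y n ∈ OrbInv F) ∧
      (∀ n : ℕ, y (n + 1) ∈ Finv F (y n)) ∧ ∀ n : ℕ, rho (x n) (y n) < ε

/-- Iterates of a set-valued map: `F^0(x) = {x}`, `F^{k+1}(x) = ⋃_{z ∈ F^k(x)} F z`. -/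
def SVIter (F : X → Set X) : ℕ → X → Set X
  | 0 => fun x => {x}
  | n + 1 => fun x => SVImage F (SVIter F n x)

/-- Prepend a point to a sequence. -/
def consSeq (a : X) (u : ℕ → X) : ℕ → X
  | 0 => a
  | n + 1 => u n

lemma consSeq_mem_orbInv {Y : Type*} {F : Y → Set Y} {a : Y} {u : ℕ → Y} (hu : u ∈ OrbInv F)
    (ha : a ∈ F (u 0)) : consSeq a u ∈ OrbInv F := by
  rintro (_ | n)
  · exact ha
  · exact hu n

lemma summable_rho (hd : ∀ a b : X, dist a b ≤ 1) (u v : ℕ → X) :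
    Summable fun n : ℕ => dist (u n) (v n) / 2 ^ (n + 1) := by
  refine Summable.of_nonneg_of_le (fun n => by positivity) (fun n => ?_)
    (summable_geometric_two' (1 : ℝ))
  rw [pow_succ', ← div_div]
  gcongr
  exact hd _ _

lemma rho_nonneg (u v : ℕ → X) : 0 ≤ rho u v :=
  tsum_nonneg fun n => by positivity

lemma rho_le_one (hd : ∀ a b : X, dist a b ≤ 1) (u v : ℕ → X) : rho u v ≤ 1 := by
  rw [← tsum_geometric_two' (1 : ℝ)]
  refine (summable_rho hd u v).tsum_le_tsum (fun n => ?_) (summable_geometric_two' (1 : ℝ))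
  rw [pow_succ', ← div_div]
  gcongr
  exact hd _ _

lemma rho_comm (u v : ℕ → X) : rho u v = rho v u := by
  simp only [rho, dist_comm]

lemma rho_triangle (hd : ∀ a b : X, dist a b ≤ 1) (u v w : ℕ → X) :
    rho u w ≤ rho u v + rho v w := by
  unfold rho
  rw [← (summable_rho hd u v).tsum_add (summable_rho hd v w)]
  refine (summable_rho hd u w).tsum_le_tsum (fun n => ?_)
    ((summable_rho hd u v).add (summable_rho hd v w))
  rw [← add_div]
  gcongr
  exact dist_triangle _ _ _

lemma rho_eq_head_add_tail (hd : ∀ a b : X, dist a b ≤ 1) (u v : ℕ → X) :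
    rho u v = dist (u 0) (v 0) / 2 + rho (shiftSeq u) (shiftSeq v) / 2 := by
  unfold rho
  rw [(summable_rho hd u v).tsum_eq_zero_add, ← tsum_div_const]
  congr 1
  · simp
  · refine tsum_congr fun n => ?_
    rw [pow_succ _ (n + 1), ← div_div]
    rfl

lemma dist_head_le_rho (hd : ∀ a b : X, dist a b ≤ 1) (u v : ℕ → X) :
    dist (u 0) (v 0) ≤ 2 * rho u v := by
  have h := rho_eq_head_add_tail hd u v
  have h' := rho_nonneg (shiftSeq u) (shiftSeq v)
  linarith

lemma rhoInf_le {u v : ℕ → X} {B : Set (ℕ → X)} (hv : v ∈ B) : rhoInf u B ≤ rho u v :=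
  csInf_le ⟨0, forall_mem_image.2 fun w _ => rho_nonneg u w⟩ (mem_image_of_mem _ hv)

lemma exists_rho_lt_of_rhoInf_lt {u : ℕ → X} {B : Set (ℕ → X)} (hB : B.Nonempty) {δ : ℝ}
    (h : rhoInf u B < δ) : ∃ v ∈ B, rho u v < δ := by
  obtain ⟨_, ⟨v, hv, rfl⟩, hlt⟩ := exists_lt_of_csInf_lt (hB.image _) h
  exact ⟨v, hv, hlt⟩

lemma SVUpperSC.isClosed_graph {F : X → Set X} (hF : SVUpperSC F)
    (hFc : SVCompactValued F) : IsClosed {p : X × X | p.2 ∈ F p.1} := by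
  rw [← isOpen_compl_iff, isOpen_iff_forall_mem_open]
  rintro ⟨x, y⟩ hxy
  obtain ⟨U, W, hU, hW, hFU, hyW, hUW⟩ :=
    SeparatedNhds.of_isCompact_isCompact (hFc x).2 isCompact_singleton
      (disjoint_singleton_right.2 hxy)
  obtain ⟨V, hV, hxV, hVU⟩ := hF x U hU hFU
  refine ⟨V ×ˢ W, ?_, hV.prod hW, hxV, hyW rfl⟩
  rintro ⟨a, b⟩ ⟨ha, hb⟩ hab
  exact disjoint_left.1 hUW (hVU a ha hab) hb

lemma SVOpen.exists_uniform_lift [CompactSpace X] {F : X → Set X} (hF : SVUpperSC F)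
    (hFc : SVCompactValued F) (hopen : SVOpen F) {η : ℝ} (hη : 0 < η) :
    ∃ δ > 0, ∀ x y y' : X, y ∈ F x → dist y y' < δ → ∃ x', dist x x' < η ∧ y' ∈ F x' := by
  obtain ⟨δ, hδ, h⟩ := lebesgue_number_lemma_of_metric
    (hF.isClosed_graph hFc).isCompact
    (c := fun x : X => ball x (η / 2) ×ˢ SVImage F (ball x (η / 2)))
    (fun x => isOpen_ball.prod (hopen _ isOpen_ball))
    (fun p hp => mem_iUnion.2 ⟨p.1, mem_ball_self (half_pos hη),
      mem_biUnion (mem_ball_self (half_pos hη)) hp⟩)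
  refine ⟨δ, hδ, fun x y y' hy hyy' => ?_⟩
  obtain ⟨c, hc⟩ := h (x, y) hy
  have hmem : (x, y') ∈ ball (x, y) δ := by
    simpa [Prod.dist_eq, hδ, dist_comm] using hyy'
  obtain ⟨hx, hy'⟩ := hc hmem
  obtain ⟨x', hx', hyx'⟩ := mem_iUnion₂.1 hy'
  refine ⟨x', ?_, hyx'⟩
  have := dist_triangle_right x x' c
  simp only [mem_ball] at hx hx'
  linarith

lemma SVOnto.exists_orbInv {Y : Type*} {F : Y → Set Y} (honto : SVOnto F) (y : Y) :
    ∃ u ∈ OrbInv F, u 0 = y := by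
  choose g hg using honto
  refine ⟨fun n => g^[n] y, fun n => ?_, rfl⟩
  simpa only [Function.iterate_succ_apply'] using hg (g^[n] y)

/-- Every inverse orbit can be followed, up to `η` in the metric `ρ`, by an inverse orbit
starting at any prescribed point sufficiently close to its head. -/
lemma SVOpen.exists_orbInv_near [CompactSpace X] (hd : ∀ a b : X, dist a b ≤ 1)
    {F : X → Set X} (hF : SVUpperSC F) (hFc : SVCompactValued F) (honto : SVOnto F)
    (hopen : SVOpen F) {η : ℝ} (hη : 0 < η) :
    ∃ δ > 0, ∀ u ∈ OrbInv F, ∀ y : X, dist (u 0) y < δ →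
      ∃ v ∈ OrbInv F, v 0 = y ∧ rho u v < η := by
  have approx : ∀ n : ℕ, ∃ δ > 0, ∀ u ∈ OrbInv F, ∀ y : X, dist (u 0) y < δ →
      ∃ v ∈ OrbInv F, v 0 = y ∧ rho u v ≤ η / 2 + (1 / 2) ^ n := by
    intro n
    induction n with
    | zero =>
      refine ⟨1, one_pos, fun u _ y _ => ?_⟩
      obtain ⟨v, hv, hv0⟩ := honto.exists_orbInv y
      refine ⟨v, hv, hv0, ?_⟩
      have := rho_le_one hd u v
      rw [pow_zero]
      linarith
    | succ n ih =>
      obtain ⟨δ, hδ, h⟩ := ih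
      obtain ⟨γ, hγ, hlift⟩ := hopen.exists_uniform_lift hF hFc hδ
      refine ⟨min γ (η / 2), lt_min hγ (half_pos hη), fun u hu y hy => ?_⟩
      obtain ⟨x', hx', hyx'⟩ := hlift (u 1) (u 0) y (hu 0) (hy.trans_le (min_le_left _ _))
      obtain ⟨v, hv, hv0, hρ⟩ := h (shiftSeq u) (fun k => hu (k + 1)) x' hx'
      refine ⟨consSeq y v, consSeq_mem_orbInv hv (hv0 ▸ hyx'), rfl, ?_⟩
      have hy' : dist (u 0) y < η / 2 := hy.trans_le (min_le_right _ _)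
      have heq : rho u (consSeq y v) = dist (u 0) y / 2 + rho (shiftSeq u) v / 2 :=
        rho_eq_head_add_tail hd u (consSeq y v)
      rw [heq, pow_succ]
      linarith
  obtain ⟨n, hn⟩ := exists_pow_lt_of_lt_one (half_pos hη) (one_half_lt_one (α := ℝ))
  obtain ⟨δ, hδ, h⟩ := approx n
  refine ⟨δ, hδ, fun u hu y hy => ?_⟩
  obtain ⟨v, hv, hv0, hρ⟩ := h u hu y hy
  exact ⟨v, hv, hv0, by linarith⟩

lemma SVShadowing.finvShadowing [CompactSpace X] (hd : ∀ a b : X, dist a b ≤ 1)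
    {F : X → Set X} (hF : SVUpperSC F) (hFc : SVCompactValued F) (honto : SVOnto F)
    (hopen : SVOpen F) (hs : SVShadowing F) : FinvShadowing F := by
  intro ε hε
  obtain ⟨γ, hγ, hnear⟩ := hopen.exists_orbInv_near hd hF hFc honto hε
  obtain ⟨δ, hδ, hshadow⟩ := hs (min γ (ε / 2)) (lt_min hγ (half_pos hε))
  refine ⟨min (δ / 2) (ε / 8), by positivity, fun z hz hpo => ?_⟩
  have hstep : ∀ n, ∃ v ∈ Finv F (z n), rho (z (n + 1)) v < min (δ / 2) (ε / 8) := fun n => by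
    obtain ⟨a, ha⟩ := (hFc (z n 0)).1
    have hne : (Finv F (z n)).Nonempty := ⟨consSeq a (z n), ha, fun _ => rfl⟩
    exact exists_rho_lt_of_rhoInf_lt hne (hpo n)
  obtain ⟨y, hy, hyz⟩ := hshadow (fun n => z n 0) fun n => by
    obtain ⟨v, hv, hρ⟩ := hstep n
    have h1 := dist_head_le_rho hd (z (n + 1)) v
    have h2 := infDist_le_dist_of_mem (x := z (n + 1) 0) hv.1
    have h3 := hρ.trans_le (min_le_left _ _)
    linarith
  obtain ⟨w₀, hw₀, hw₀0, hρ₀⟩ := hnear (z 0) (hz 0) (y 0) ((hyz 0).trans_le (min_le_left _ _))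
  let w : ℕ → ℕ → X := fun n => Nat.rec w₀ (fun k v => consSeq (y (k + 1)) v) n
  have hw0 : ∀ n, w n 0 = y n := by
    rintro (_ | n)
    · exact hw₀0
    · rfl
  have hhead : ∀ n, y (n + 1) ∈ F (w n 0) := fun n => (hw0 n).symm ▸ hy n
  refine ⟨w, fun n => ?_, fun n => ⟨hhead n, fun _ => rfl⟩, fun n => ?_⟩
  · induction n with
    | zero => exact hw₀
    | succ n ih => exact consSeq_mem_orbInv ih (hhead n)
  · induction n with
    | zero => exact hρ₀
    | succ n ih =>
      obtain ⟨v, ⟨-, hv⟩, hρ⟩ := hstep n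
      have htail : shiftSeq v = z n := funext hv
      have heq : rho v (w (n + 1)) = dist (v 0) (y (n + 1)) / 2 + rho (z n) (w n) / 2 := by
        rw [rho_eq_head_add_tail hd, htail]
        rfl
      have h1 := rho_triangle hd (z (n + 1)) v (w (n + 1))
      have h2 := dist_head_le_rho hd (z (n + 1)) v
      have h3 := dist_triangle_left (v 0) (y (n + 1)) (z (n + 1) 0)
      have h4 := (hyz (n + 1)).trans_le (min_le_right _ _)
      have h5 := hρ.trans_le (min_le_right _ _)
      linarith

lemma FinvShadowing.svShadowing [CompactSpace X] (hd : ∀ a b : X, dist a b ≤ 1)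
    {F : X → Set X} (hF : SVUpperSC F) (hFc : SVCompactValued F) (honto : SVOnto F)
    (hopen : SVOpen F) (hs : FinvShadowing F) : SVShadowing F := by
  intro ε hε
  obtain ⟨δ, hδ, hshadow⟩ := hs (ε / 2) (half_pos hε)
  obtain ⟨γ, hγ, hnear⟩ := hopen.exists_orbInv_near hd hF hFc honto hδ
  refine ⟨γ, hγ, fun x hpo => ?_⟩
  have hext : ∀ n, ∀ u : {u : ℕ → X // u ∈ OrbInv F ∧ u 0 = x n},
      ∃ v : {v : ℕ → X // v ∈ OrbInv F ∧ v 0 = x (n + 1)}, rhoInf v.1 (Finv F u.1) < δ := by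
    rintro n ⟨u, hu, hu0⟩
    obtain ⟨a, ha, hdist⟩ := (infDist_lt_iff (hFc (x n)).1).1 (hpo n)
    have ha' : a ∈ F (u 0) := hu0.symm ▸ ha
    obtain ⟨v, hv, hv0, hρ⟩ := hnear (consSeq a u) (consSeq_mem_orbInv hu ha') (x (n + 1))
      (by rwa [dist_comm] at hdist)
    refine ⟨⟨v, hv, hv0⟩, lt_of_le_of_lt (rhoInf_le (v := consSeq a u) ⟨ha', fun _ => rfl⟩) ?_⟩
    rwa [rho_comm]
  choose next hnext using hext
  obtain ⟨u₀, hu₀⟩ := honto.exists_orbInv (x 0)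
  let z : ∀ n, {u : ℕ → X // u ∈ OrbInv F ∧ u 0 = x n} := fun n => Nat.rec ⟨u₀, hu₀⟩ next n
  obtain ⟨w, -, hw, hzw⟩ := hshadow (fun n => (z n).1) (fun n => (z n).2.1)
    (fun n => hnext n (z n))
  refine ⟨fun n => w n 0, fun n => (hw n).1, fun n => ?_⟩
  have h1 := dist_head_le_rho hd (z n).1 (w n)
  rw [(z n).2.2] at h1
  have h2 := hzw n
  linarith

/-- For an upper semicontinuous, onto and open set-valued map `F` with
nonempty compact values on a compact metric space of diameter at most 1, `F` has the
shadowing property iff the induced inverse set-valued map `F_inv` on `(Orb_inv(X), ρ)` has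
the shadowing property. -/
theorem svShadowing_iff_finvShadowing_of_open [CompactSpace X]
    (hdiam : diam (univ : Set X) ≤ 1)
    (F : X → Set X) (hF : SVUpperSC F) (hFc : SVCompactValued F)
    (honto : SVOnto F) (hopen : SVOpen F) :
    SVShadowing F ↔ FinvShadowing F := by
  have hd : ∀ a b : X, dist a b ≤ 1 := fun a b =>
    (dist_le_diam_of_mem isCompact_univ.isBounded (mem_univ a) (mem_univ b)).trans hdiam
  exact ⟨SVShadowing.finvShadowing hd hF hFc honto hopen,
    FinvShadowing.svShadowing hd hF hFc honto hopen⟩
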